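/- Let p, q be real numbers with 1 + p ≥ q ≥ p > 0 and let (P_n(x;p,q))_{n≥0} be the generalized Eulerian polynomials of Carlitz–Scoville, defined by P_0(x;p,q) = 1 and P_{n+1}(x;p,q) = (n x + p x + q) P_n(x;p,q) + x(1 − x) ∂_x P_n(x;p,q) for n ≥ 0, so that deg P_n(x;p,q) = n. Then for every n ≥ 1 the polynomial P_n(x;p,q) is ratio monotone. -/

import Mathlib

open Polynomial

/-- A real polynomial `p = a_0 + a_1 X + ⋯ + a_n X^n` of degree `n` with positive
coefficients is ratio monotone if
`a_n/a_0 ≤ a_(n-1)/a_1 ≤ ⋯ ≤ a_(n-⌊(n-1)/2⌋)/a_(⌊(n-1)/2⌋) ≤ 1` and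
`a_0/a_(n-1) ≤ a_1/a_(n-2) ≤ ⋯ ≤ a_(⌊n/2⌋-1)/a_(n-⌊n/2⌋) ≤ 1`. -/
def RatioMonotone (p : Polynomial ℝ) : Prop :=
  (∀ i ≤ p.natDegree, 0 < p.coeff i) ∧
  (∀ i : ℕ, i + 1 ≤ (p.natDegree - 1) / 2 →
    p.coeff (p.natDegree - i) / p.coeff i ≤
      p.coeff (p.natDegree - (i + 1)) / p.coeff (i + 1)) ∧
  (p.coeff (p.natDegree - (p.natDegree - 1) / 2) / p.coeff ((p.natDegree - 1) / 2) ≤ 1) ∧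
  (∀ i : ℕ, i + 2 ≤ p.natDegree / 2 →
    p.coeff i / p.coeff (p.natDegree - 1 - i) ≤
      p.coeff (i + 1) / p.coeff (p.natDegree - 1 - (i + 1))) ∧
  (1 ≤ p.natDegree / 2 →
    p.coeff (p.natDegree / 2 - 1) / p.coeff (p.natDegree - p.natDegree / 2) ≤ 1)

/-- The polynomial inequality behind the induction step for both chains of ratios. -/
lemma mul_le_mul_of_cross_le {e f d x₀ x₁ x₂ y₀ y₁ y₂ : ℝ} (he : 0 ≤ e) (hf : 0 ≤ f) (hd : 0 ≤ d)
    (hx₀ : 0 ≤ x₀) (hx₁ : 0 < x₁) (hx₂ : 0 ≤ x₂) (hy₀ : 0 ≤ y₀) (hy₁ : 0 < y₁) (hy₂ : 0 ≤ y₂)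
    (h₁ : x₂ * y₁ ≤ x₁ * y₀) (h₂ : x₁ * y₂ ≤ x₀ * y₁) (h₃ : x₀ * y₀ ≤ x₁ * y₁) :
    ((e + d + 1) * x₂ + f * x₁) * ((f + d + 1) * y₂ + e * y₁) ≤
      ((e + d) * x₁ + (f + 1) * x₀) * ((f + d) * y₁ + (e + 1) * y₀) := by
  have hz : 0 < x₁ * y₁ := mul_pos hx₁ hy₁
  have hw : x₂ * y₂ ≤ x₀ * y₀ := by
    have h := mul_le_mul h₁ h₂ (by positivity) (by positivity)
    refine le_of_mul_le_mul_right ?_ hz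
    linarith
  have hw₀ : 0 ≤ x₂ * y₂ := by positivity
  have hsum : 2 * (x₂ * y₂) ≤ x₁ * y₀ + x₀ * y₁ := by
    refine abs_le_of_sq_le_sq' ?_ (by positivity) |>.2
    have h : (x₂ * y₂) * (x₂ * y₂) ≤ (x₀ * y₀) * (x₁ * y₁) :=
      mul_le_mul hw (hw.trans h₃) hw₀ (by positivity)
    nlinarith [sq_nonneg (x₁ * y₀ - x₀ * y₁)]
  have k₁ : 0 ≤ (e + d + 1) * e * (x₁ * y₀ - x₂ * y₁) :=
    mul_nonneg (by positivity) (sub_nonneg.2 h₁)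
  have k₂ : 0 ≤ (f + d + 1) * f * (x₀ * y₁ - x₁ * y₂) :=
    mul_nonneg (by positivity) (sub_nonneg.2 h₂)
  have k₃ : 0 ≤ (e + 1) * (f + 1) * (x₀ * y₀ - x₂ * y₂) :=
    mul_nonneg (by positivity) (sub_nonneg.2 hw)
  have k₄ : 0 ≤ d * (e + f + d) * (x₁ * y₁ - x₂ * y₂) :=
    mul_nonneg (by positivity) (sub_nonneg.2 (hw.trans h₃))
  have k₅ : 0 ≤ d * (x₁ * y₀ + x₀ * y₁ - 2 * (x₂ * y₂)) :=
    mul_nonneg hd (sub_nonneg.2 hsum)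
  linear_combination k₁ + k₂ + k₃ + k₄ + k₅

/-- The coefficients of a polynomial indexed by `ℤ`, vanishing at negative indices. -/
noncomputable def Polynomial.intCoeff (P : Polynomial ℝ) (k : ℤ) : ℝ :=
  if 0 ≤ k then P.coeff k.toNat else 0

namespace Polynomial

lemma intCoeff_natCast (P : Polynomial ℝ) (k : ℕ) : P.intCoeff k = P.coeff k := by
  simp [intCoeff]

lemma intCoeff_of_neg (P : Polynomial ℝ) {k : ℤ} (hk : k < 0) : P.intCoeff k = 0 := by
  simp [intCoeff, hk]

lemma intCoeff_of_natDegree_lt (P : Polynomial ℝ) {k : ℤ} (hk : P.natDegree < k) :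
    P.intCoeff k = 0 := by
  lift k to ℕ using by omega
  rw [intCoeff_natCast]
  exact coeff_eq_zero_of_natDegree_lt (by exact_mod_cast hk)

lemma intCoeff_carlitzScoville_step (P : Polynomial ℝ) (r q : ℝ) (k : ℤ) :
    ((C r * X + C q) * P + X * (1 - X) * derivative P).intCoeff k =
      (k + q) * P.intCoeff k + (r - k + 1) * P.intCoeff (k - 1) := by
  have hP : (C r * X + C q) * P + X * (1 - X) * derivative P =
      C r * (X * P) + C q * P + (X * derivative P - X * (X * derivative P)) := by ring
  rw [hP]
  rcases lt_or_ge k 0 with hk | hk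
  · simp [intCoeff_of_neg _ hk, intCoeff_of_neg P (show k - 1 < 0 by omega)]
  lift k to ℕ using hk
  rcases k with _ | k
  · rw [intCoeff_natCast, intCoeff_natCast, intCoeff_of_neg P (by simp)]
    simp
  · rw [intCoeff_natCast, intCoeff_natCast, show ((k + 1 : ℕ) : ℤ) - 1 = (k : ℕ) by simp,
      intCoeff_natCast]
    simp only [coeff_add, coeff_sub, coeff_C_mul, coeff_X_mul, coeff_derivative]
    rcases k with _ | k
    · simp
      ring
    · simp only [coeff_X_mul, coeff_derivative]
      push_cast
      ring

/-- The cross-multiplied form of both chains of ratio monotonicity for a polynomial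
regarded as having degree `n`. -/
structure RatioCross (P : Polynomial ℝ) (n : ℤ) : Prop where
  pos : ∀ k, 0 ≤ k → k ≤ n → 0 < P.intCoeff k
  eq_zero : ∀ k, n < k → P.intCoeff k = 0
  succ_mul_succ_le : ∀ i j, i + j = n - 1 →
    P.intCoeff (i + 1) * P.intCoeff (j + 1) ≤ P.intCoeff i * P.intCoeff j
  pred_mul_pred_le : ∀ i j, i + j = n →
    P.intCoeff (i - 1) * P.intCoeff (j - 1) ≤ P.intCoeff i * P.intCoeff j

namespace RatioCross

lemma nonneg {P : Polynomial ℝ} {n : ℤ} (h : P.RatioCross n) (k : ℤ) : 0 ≤ P.intCoeff k := by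
  rcases lt_or_ge k 0 with hk | hk
  · exact (intCoeff_of_neg P hk).ge
  rcases lt_or_ge n k with hn | hn
  · exact (h.eq_zero k hn).ge
  · exact (h.pos k hk hn).le

lemma one : (1 : Polynomial ℝ).RatioCross 0 where
  pos k h₀ h₁ := by
    obtain rfl : k = 0 := le_antisymm h₁ h₀
    simp [intCoeff]
  eq_zero k hk := intCoeff_of_natDegree_lt _ (by simpa using hk)
  succ_mul_succ_le i j hij := by
    have h : ∀ k : ℤ, k ≠ 0 → (1 : Polynomial ℝ).intCoeff k = 0 := fun k hk ↦ by
      rcases hk.lt_or_gt with hk | hk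
      · exact intCoeff_of_neg _ hk
      · exact intCoeff_of_natDegree_lt _ (by simpa using hk)
    rcases eq_or_ne i (-1) with rfl | hi
    · rw [h (j + 1) (by omega), h (-1) (by omega)]; simp
    · rw [h (i + 1) (by omega)]
      rcases eq_or_ne i 0 with rfl | hi
      · rw [h j (by omega)]; simp
      · rw [h i hi]; simp
  pred_mul_pred_le i j hij := by
    rcases le_or_gt i 0 with hi | hi
    · rw [intCoeff_of_neg _ (show i - 1 < 0 by omega), zero_mul]
      simp only [intCoeff, coeff_one]
      split_ifs <;> simp
    · rw [intCoeff_of_neg _ (show j - 1 < 0 by omega), intCoeff_of_neg _ (show j < 0 by omega)]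
      simp

lemma carlitzScoville_step {P : Polynomial ℝ} {n : ℕ} (h : P.RatioCross n) {p q : ℝ}
    (hp : 0 < p) (hqp : p ≤ q) (hq1 : q ≤ 1 + p) :
    ((C ((n : ℝ) + p) * X + C q) * P + X * (1 - X) * derivative P).RatioCross
      (n + 1 : ℕ) := by
  set Q := (C ((n : ℝ) + p) * X + C q) * P + X * (1 - X) * derivative P
  have hrec : ∀ k : ℤ, Q.intCoeff k =
      (k + q) * P.intCoeff k + (n + p - k + 1) * P.intCoeff (k - 1) :=
    intCoeff_carlitzScoville_step P _ q
  have hQpos : ∀ k : ℤ, 0 ≤ k → k ≤ (n + 1 : ℕ) → 0 < Q.intCoeff k := by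
    intro k hk hkn
    have hk' : (0 : ℝ) ≤ k := by exact_mod_cast hk
    have hkn' : (k : ℝ) ≤ n + 1 := by exact_mod_cast hkn
    rw [hrec]
    rcases hk.eq_or_lt with rfl | hk
    · have := mul_pos (hp.trans_le hqp) (h.pos 0 le_rfl (by omega))
      rw [intCoeff_of_neg P (show (0 : ℤ) - 1 < 0 by omega)]
      simpa using this
    · have := mul_pos (show (0 : ℝ) < n + p - k + 1 by linarith)
        (h.pos (k - 1) (by omega) (by push_cast at hkn; omega))
      have := mul_nonneg (show (0 : ℝ) ≤ k + q by linarith) (h.nonneg k)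
      linarith
  have hQzero : ∀ k : ℤ, (n + 1 : ℕ) < k → Q.intCoeff k = 0 := by
    intro k hk
    push_cast at hk
    rw [hrec, h.eq_zero k (by omega), h.eq_zero (k - 1) (by omega)]
    ring
  have hQnonneg : ∀ k : ℤ, 0 ≤ Q.intCoeff k := by
    intro k
    rcases lt_or_ge k 0 with hk | hk
    · exact (intCoeff_of_neg Q hk).ge
    rcases lt_or_ge ((n + 1 : ℕ) : ℤ) k with hn | hn
    · exact (hQzero k hn).ge
    · exact (hQpos k hk hn).le
  refine ⟨hQpos, hQzero, fun i j hij ↦ ?_, fun i j hij ↦ ?_⟩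
  · have hij : i + j = n := by push_cast at hij; omega
    have hijr : (n : ℝ) = i + j := by exact_mod_cast hij.symm
    rcases lt_or_ge i 0 with hi | hi
    · rw [hQzero (j + 1) (by push_cast; omega), mul_zero]
      exact mul_nonneg (hQnonneg _) (hQnonneg _)
    rcases lt_or_ge j 0 with hj | hj
    · rw [hQzero (i + 1) (by push_cast; omega), zero_mul]
      exact mul_nonneg (hQnonneg _) (hQnonneg _)
    have hi' : (0 : ℝ) ≤ i := by exact_mod_cast hi
    have hj' : (0 : ℝ) ≤ j := by exact_mod_cast hj
    have h₁ := h.succ_mul_succ_le i (j - 1) (by omega)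
    have h₂ := h.succ_mul_succ_le (i - 1) j (by omega)
    have key := mul_le_mul_of_cross_le (e := i + p) (f := j + p) (d := q - p)
      (by linarith) (by linarith) (by linarith)
      (h.nonneg (i - 1)) (h.pos i hi (by omega)) (h.nonneg (i + 1))
      (h.nonneg (j - 1)) (h.pos j hj (by omega)) (h.nonneg (j + 1))
      (by simpa using h₁) (by simpa using h₂) (h.pred_mul_pred_le i j hij)
    simp only [hrec, add_sub_cancel_right, hijr]
    push_cast
    convert key using 1 <;> ring
  · have hij : i + j = n + 1 := by push_cast at hij; omega
    have hijr : (n : ℝ) = i + j - 1 := by rw [eq_sub_iff_add_eq]; exact_mod_cast hij.symm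
    rcases lt_or_ge (i - 1) 0 with hi | hi
    · rw [intCoeff_of_neg Q hi, zero_mul]
      exact mul_nonneg (hQnonneg _) (hQnonneg _)
    rcases lt_or_ge (j - 1) 0 with hj | hj
    · rw [intCoeff_of_neg Q hj, mul_zero]
      exact mul_nonneg (hQnonneg _) (hQnonneg _)
    have hi' : (1 : ℝ) ≤ i := by exact_mod_cast (by omega : 1 ≤ i)
    have hj' : (1 : ℝ) ≤ j := by exact_mod_cast (by omega : 1 ≤ j)
    have h₁ := h.pred_mul_pred_le (i - 1) j (by omega)
    have h₂ := h.pred_mul_pred_le i (j - 1) (by omega)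
    have h₃ := h.succ_mul_succ_le (i - 1) (j - 1) (by omega)
    have key := mul_le_mul_of_cross_le (e := j - 1 + q) (f := i - 1 + q) (d := 1 + p - q)
      (by linarith) (by linarith) (by linarith)
      (h.nonneg i) (h.pos (i - 1) hi (by omega)) (h.nonneg (i - 1 - 1))
      (h.nonneg j) (h.pos (j - 1) hj (by omega)) (h.nonneg (j - 1 - 1))
      h₁ h₂ (by simpa using h₃)
    simp only [hrec, hijr]
    push_cast
    convert key using 1 <;> ring

lemma ratioMonotone {P : Polynomial ℝ} (h : P.RatioCross P.natDegree) (hP : 1 ≤ P.natDegree) :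
    RatioMonotone P := by
  set n := P.natDegree with hn
  have hpos : ∀ i ≤ n, 0 < P.coeff i := fun i hi ↦ by
    rw [← intCoeff_natCast]
    exact h.pos i (by omega) (by omega)
  have hsucc : ∀ i j : ℕ, i + j + 1 = n →
      P.coeff (i + 1) * P.coeff (j + 1) ≤ P.coeff i * P.coeff j := fun i j hij ↦ by
    simp only [← intCoeff_natCast]
    exact_mod_cast h.succ_mul_succ_le i j (by omega)
  have hpred : ∀ i j : ℕ, i + j + 2 = n →
      P.coeff i * P.coeff j ≤ P.coeff (i + 1) * P.coeff (j + 1) := fun i j hij ↦ by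
    simp only [← intCoeff_natCast]
    simpa using h.pred_mul_pred_le (i + 1 : ℕ) (j + 1 : ℕ) (by omega)
  refine ⟨hpos, fun i hi ↦ ?_, ?_, fun i hi ↦ ?_, fun hm ↦ ?_⟩ <;> rw [← hn] at *
  · rw [div_le_div_iff₀ (hpos _ (by omega)) (hpos _ (by omega))]
    have := hsucc i (n - (i + 1)) (by omega)
    rw [show n - (i + 1) + 1 = n - i by omega] at this
    linarith
  · rw [div_le_one (hpos _ (by omega))]
    obtain ⟨k, hk | hk⟩ : ∃ k, n = 2 * k + 1 ∨ n = 2 * k + 2 := ⟨(n - 1) / 2, by omega⟩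
    · have := hsucc k k (by omega)
      rw [show (n - 1) / 2 = k by omega, show n - k = k + 1 by omega]
      exact (mul_self_le_mul_self_iff (hpos _ (by omega)).le (hpos _ (by omega)).le).2 this
    · have := hsucc k (k + 1) (by omega)
      rw [show (n - 1) / 2 = k by omega, show n - k = k + 1 + 1 by omega]
      refine le_of_mul_le_mul_right ?_ (hpos (k + 1) (by omega))
      linarith
  · rw [div_le_div_iff₀ (hpos _ (by omega)) (hpos _ (by omega))]
    have := hpred i (n - 1 - (i + 1)) (by omega)
    rw [show n - 1 - (i + 1) + 1 = n - 1 - i by omega] at this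
    linarith
  · rw [div_le_one (hpos _ (by omega))]
    obtain ⟨k, hk | hk⟩ : ∃ k, n = 2 * k + 2 ∨ n = 2 * k + 3 := ⟨n / 2 - 1, by omega⟩
    · have := hpred k k (by omega)
      rw [show n / 2 - 1 = k by omega, show n - n / 2 = k + 1 by omega]
      exact (mul_self_le_mul_self_iff (hpos _ (by omega)).le (hpos _ (by omega)).le).2 this
    · have := hpred k (k + 1) (by omega)
      rw [show n / 2 - 1 = k by omega, show n - n / 2 = k + 1 + 1 by omega]
      refine le_of_mul_le_mul_right ?_ (hpos (k + 1) (by omega))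
      linarith

end RatioCross

end Polynomial

/-- for `1 + p ≥ q ≥ p > 0`, the Carlitz–Scoville generalized
Eulerian polynomials `P n` are ratio monotone for `n ≥ 1`. -/
theorem stmt16 (p q : ℝ) (hp : 0 < p) (hqp : p ≤ q) (hq1 : q ≤ 1 + p)
    (P : ℕ → Polynomial ℝ) (hP0 : P 0 = 1)
    (hrec : ∀ n : ℕ, P (n + 1) =
      (Polynomial.C ((n : ℝ) + p) * Polynomial.X + Polynomial.C q) * P n +
        Polynomial.X * (1 - Polynomial.X) * Polynomial.derivative (P n))
    (hdeg : ∀ n : ℕ, (P n).natDegree = n) :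
    ∀ n : ℕ, 1 ≤ n → RatioMonotone (P n) := by
  have hcross : ∀ n : ℕ, (P n).RatioCross n := by
    intro n
    induction n with
    | zero => rw [hP0]; exact RatioCross.one
    | succ n ih => rw [hrec]; exact ih.carlitzScoville_step hp hqp hq1
  intro n hn
  exact RatioCross.ratioMonotone (by rw [hdeg]; exact hcross n) (by rwa [hdeg])
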